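/- Let {Cₙ : n ∈ ω} be an increasing sequence of countable sets with C₀ = ∅ and C = ⋃ₙ Cₙ, let B be an arbitrary set, and let Z, F be closed subsets of ℝ^{B∪C} × ℝ^{B∪C}. Suppose there are continuous maps φₙ, ψₙ : ℝ^{B∪Cₙ} × ℝ^{B∪Cₙ} → ℝ^{B∪Cₙ} × ℝ^{B∪Cₙ} for n ≥ 1 such that: (1) π₁ ∘ φₙ = π₁ and (2) π₁ ∘ ψₙ = π₁, where π₁ is the projection onto the first factor; (3) φₙ₊₁ is (B∪Cₙ)-invariant and (4) ψₙ₊₁ is (B∪Cₙ)-invariant; (5) (π_{B∪Cₙ} × π_{B∪Cₙ})(Z) and the image of φₙ are functionally separated in ℝ^{B∪Cₙ} × ℝ^{B∪Cₙ} for n ≥ 1; (6) (π_{B∪Cₙ} × π_{B∪Cₙ})(F) and the image of ψₙ are functionally separated for n ≥ 1. Let f, g : ℝ^{B∪C} × ℝ^{B∪C} → ℝ^{B∪C} × ℝ^{B∪C} be continuous maps such that (7) f(Z) = F and g(F) = Z; (8) (g ∘ f)|Z = id_Z and (f ∘ g)|F = id_F; (9) π₁ ∘ f = π₁ and π₁ ∘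 g = π₁; (10) f and g are (B∪C₀)-invariant (i.e. B-invariant, since C₀ = ∅). Then the homeomorphism h = f|Z : Z → F extends to a homeomorphism H : ℝ^{B∪C} × ℝ^{B∪C} → ℝ^{B∪C} × ℝ^{B∪C} such that π₁ ∘ H = π₁ and (π_B × π_B) ∘ H = π_B × π_B. -/

import Mathlib

open Set Topology

universe u

/-- Restriction (projection) of `ℝ^A` onto the subproduct `ℝ^D`, `D ⊆ A`. -/
def resTo {A : Type u} (D : Set A) (x : A → ℝ) : ↥D → ℝ := fun d => x d

/-- Projection `π_D × π_D : ℝ^A × ℝ^A → ℝ^D × ℝ^D`. -/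
def resToP {A : Type u} (D : Set A) (x : (A → ℝ) × (A → ℝ)) : (↥D → ℝ) × (↥D → ℝ) :=
  (resTo D x.1, resTo D x.2)

/-- Projection `π_D × π_D : ℝ^E × ℝ^E → ℝ^D × ℝ^D` for `D ⊆ E`. -/
def resSubP {A : Type u} {D E : Set A} (h : D ⊆ E) (x : (↥E → ℝ) × (↥E → ℝ)) :
    (↥D → ℝ) × (↥D → ℝ) :=
  (fun d => x.1 ⟨d.1, h d.2⟩, fun d => x.2 ⟨d.1, h d.2⟩)

/-- Two sets are functionally separated if some continuous `[0,1]`-valued function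
is `0` on the first and `1` on the second. -/
def FunctionallySeparated {X : Type*} [TopologicalSpace X] (P Q : Set X) : Prop :=
  ∃ φ : X → ℝ, Continuous φ ∧ (∀ x, φ x ∈ Set.Icc (0 : ℝ) 1) ∧
    (∀ p ∈ P, φ p = 0) ∧ (∀ q ∈ Q, φ q = 1)

section FiberMaps

variable {P : Type*} [TopologicalSpace P] {A : Type*}

/-- Adding to the `S`-coordinates a function of the remaining coordinates. -/
noncomputable def shear (S : Set A) (r : P × (A → ℝ) → A → ℝ) (hr : Continuous r)
    (hS : ∀ w w', w.1 = w'.1 → (∀ i ∉ S, w.2 i = w'.2 i) → r w = r w') :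
    (P × (A → ℝ)) ≃ₜ (P × (A → ℝ)) where
  toFun w := (w.1, fun i => w.2 i + S.indicator (r w) i)
  invFun w := (w.1, fun i => w.2 i - S.indicator (r w) i)
  left_inv w := by
    refine Prod.ext rfl (funext fun i => ?_)
    dsimp only
    rw [hS (w.1, fun i => w.2 i + S.indicator (r w) i) w rfl fun i hi => by simp [hi]]
    ring
  right_inv w := by
    refine Prod.ext rfl (funext fun i => ?_)
    dsimp only
    rw [hS (w.1, fun i => w.2 i - S.indicator (r w) i) w rfl fun i hi => by simp [hi]]
    ring
  continuous_toFun := by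
    refine continuous_fst.prodMk (continuous_pi fun i => ?_)
    by_cases hi : i ∈ S <;> simp only [Set.indicator, hi, if_true, if_false] <;> fun_prop
  continuous_invFun := by
    refine continuous_fst.prodMk (continuous_pi fun i => ?_)
    by_cases hi : i ∈ S <;> simp only [Set.indicator, hi, if_true, if_false] <;> fun_prop

/-- If `h` fixes the coordinates outside `M` and its `M`-coordinates depend only on the
`M`-coordinates of the argument, then so does its inverse. -/
theorem symm_congr_of_congr {h : (P × (A → ℝ)) ≃ₜ (P × (A → ℝ))} {M : Set A}
    (h1 : ∀ w, (h w).1 = w.1) (hfix : ∀ w, ∀ i ∉ M, (h w).2 i = w.2 i)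
    (hdep : ∀ w w', w.1 = w'.1 → (∀ i ∈ M, w.2 i = w'.2 i) →
      ∀ i ∈ M, (h w).2 i = (h w').2 i)
    {w w' : P × (A → ℝ)} (hw1 : w.1 = w'.1) (hw : ∀ i ∈ M, w.2 i = w'.2 i) :
    ∀ i ∈ M, (h.symm w).2 i = (h.symm w').2 i := by
  classical
  have e1 : ∀ w, (h.symm w).1 = w.1 := fun w => by
    rw [← h1 (h.symm w), h.apply_symm_apply]
  set v : P × (A → ℝ) :=
    ((h.symm w).1, fun i => if i ∈ M then (h.symm w).2 i else (h.symm w').2 i) with hv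
  have key : h v = w' := by
    refine Prod.ext ?_ (funext fun i => ?_)
    · rw [h1, hv, e1, hw1]
    · by_cases hi : i ∈ M
      · rw [hdep v (h.symm w) rfl (fun j hj => by simp [hv, hj]) i hi, h.apply_symm_apply, hw i hi]
      · rw [hfix v i hi]
        simp only [hv, hi, if_false]
        rw [← hfix _ i hi, h.apply_symm_apply]
  intro i hi
  rw [← key, h.symm_apply_apply]
  simp [hv, hi]

/-- A triangular sequence of homeomorphisms, the `n`-th of which acts on the `n`-th block of
coordinates with the earlier blocks as parameters, assembles into one homeomorphism. -/
theorem exists_homeomorph_of_tower (M : ℕ → Set A) (hM : Monotone M) (hcov : ∀ i, ∃ n, i ∈ M n)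
    (h : ℕ → (P × (A → ℝ)) ≃ₜ (P × (A → ℝ))) (h1 : ∀ n w, (h n w).1 = w.1)
    (hfix : ∀ n w, ∀ i ∉ M (n + 1) \ M n, (h n w).2 i = w.2 i)
    (hdep : ∀ n w w', w.1 = w'.1 → (∀ i ∈ M (n + 1), w.2 i = w'.2 i) →
      ∀ i ∈ M (n + 1), (h n w).2 i = (h n w').2 i) :
    ∃ H : (P × (A → ℝ)) ≃ₜ (P × (A → ℝ)), (∀ w, (H w).1 = w.1) ∧
      (∀ w, ∀ i ∈ M 0, (H w).2 i = w.2 i) ∧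
      ∀ n w, ∀ i ∈ M (n + 1) \ M n, (H w).2 i = (h n w).2 i := by
  choose N hN using hcov
  let E : ℕ → (P × (A → ℝ)) ≃ₜ (P × (A → ℝ)) := fun n =>
    Nat.rec (Homeomorph.refl _) (fun k e => (h k).trans e) n
  have E0 : E 0 = Homeomorph.refl _ := rfl
  have ES : ∀ n w, E (n + 1) w = E n (h n w) := fun n w => rfl
  have ESs : ∀ n w, (E (n + 1)).symm w = (h n).symm ((E n).symm w) := fun n w => rfl
  have hs1 : ∀ n w, ((h n).symm w).1 = w.1 := fun n w => by
    rw [← h1 n ((h n).symm w), Homeomorph.apply_symm_apply]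
  have hsfix : ∀ n w, ∀ i ∉ M (n + 1) \ M n, ((h n).symm w).2 i = w.2 i := fun n w i hi => by
    rw [← hfix n _ i hi, Homeomorph.apply_symm_apply]
  have E1 : ∀ n w, (E n w).1 = w.1 := by
    intro n
    induction n with
    | zero => intro w; rfl
    | succ n ih => intro w; rw [ES, ih, h1]
  have Es1 : ∀ n w, ((E n).symm w).1 = w.1 := fun n w => by
    rw [← E1 n ((E n).symm w), Homeomorph.apply_symm_apply]
  have Efix : ∀ n w, ∀ i ∉ M n, (E n w).2 i = w.2 i := by
    intro n
    induction n with
    | zero => intro w i _; rfl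
    | succ n ih =>
      intro w i hi
      rw [ES, ih _ i fun hh => hi (hM n.le_succ hh), hfix n w i fun hh => hi hh.1]
  have Edep : ∀ n w w', w.1 = w'.1 → (∀ i ∈ M n, w.2 i = w'.2 i) →
      ∀ i ∈ M n, (E n w).2 i = (E n w').2 i := by
    intro n
    induction n with
    | zero => intro w w' _ hw; exact hw
    | succ n ih =>
      intro w w' hw1 hw i hi
      rw [ES, ES]
      have hd := hdep n w w' hw1 hw
      by_cases hin : i ∈ M n
      · exact ih _ _ (by rw [h1, h1, hw1]) (fun j hj => hd j (hM n.le_succ hj)) i hin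
      · rw [Efix n _ i hin, Efix n _ i hin, hd i hi]
  have Esdep : ∀ n w w', w.1 = w'.1 → (∀ i ∈ M n, w.2 i = w'.2 i) →
      ∀ i ∈ M n, ((E n).symm w).2 i = ((E n).symm w').2 i := fun n w w' hw1 hw =>
    symm_congr_of_congr (E1 n) (Efix n) (Edep n) hw1 hw
  have Estep : ∀ n m w, n ≤ m → ∀ i ∈ M n, (E m w).2 i = (E n w).2 i := by
    intro n m w hnm
    induction m, hnm using Nat.le_induction generalizing w with
    | base => intro i _; rfl
    | succ m hm ih =>
      intro i hi
      rw [ES, ih _ i hi]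
      exact Edep n _ _ (h1 m w)
        (fun j hj => hfix m w j fun hh => hh.2 (hM hm hj)) i hi
  have Esstep : ∀ n m w, n ≤ m → ∀ i ∈ M n, ((E m).symm w).2 i = ((E n).symm w).2 i := by
    intro n m w hnm
    induction m, hnm using Nat.le_induction with
    | base => intro i _; rfl
    | succ m hm ih =>
      intro i hi
      rw [ESs, hsfix m _ i fun hh => hh.2 (hM hm hi), ih i hi]
  let T : P × (A → ℝ) → P × (A → ℝ) := fun w => (w.1, fun i => (E (N i) w).2 i)
  let S : P × (A → ℝ) → P × (A → ℝ) := fun w => (w.1, fun i => ((E (N i)).symm w).2 i)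
  have hT : ∀ n w, ∀ i ∈ M n, (T w).2 i = (E n w).2 i := by
    intro n w i hi
    rcases le_total (N i) n with hle | hle
    · exact (Estep _ _ w hle i (hN i)).symm
    · exact Estep _ _ w hle i hi
  have hS : ∀ n w, ∀ i ∈ M n, (S w).2 i = ((E n).symm w).2 i := by
    intro n w i hi
    rcases le_total (N i) n with hle | hle
    · exact (Esstep _ _ w hle i (hN i)).symm
    · exact Esstep _ _ w hle i hi
  refine ⟨⟨⟨T, S, fun w => ?_, fun w => ?_⟩, ?_, ?_⟩, fun w => rfl, fun w i hi => ?_,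
    fun n w i hi => ?_⟩
  · refine Prod.ext rfl (funext fun i => ?_)
    have := Esdep (N i) (T w) (E (N i) w) (E1 _ w).symm (hT _ w) i (hN i)
    rwa [Homeomorph.symm_apply_apply] at this
  · refine Prod.ext rfl (funext fun i => ?_)
    have := Edep (N i) (S w) ((E (N i)).symm w) (Es1 _ w).symm (hS _ w) i (hN i)
    rwa [Homeomorph.apply_symm_apply] at this
  · exact continuous_fst.prodMk (continuous_pi fun i =>
      (continuous_apply i).comp (continuous_snd.comp (E (N i)).continuous))
  · exact continuous_fst.prodMk (continuous_pi fun i =>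
      (continuous_apply i).comp (continuous_snd.comp (E (N i)).symm.continuous))
  · exact hT 0 w i hi
  · refine (hT (n + 1) w i hi.1).trans ?_
    rw [ES, Efix n _ i hi.2]

end FiberMaps

section Absorb

/-- Truncation of a real number to `[-δ, δ]`. -/
noncomputable def clip (δ x : ℝ) : ℝ := max (-δ) (min δ x)

theorem continuous_clip (δ : ℝ) : Continuous (clip δ) := by
  unfold clip; fun_prop

theorem abs_clip_le {δ : ℝ} (hδ : 0 ≤ δ) (x : ℝ) : |clip δ x| ≤ δ :=
  abs_le.2 ⟨le_max_left _ _, max_le (by linarith) (min_le_left _ _)⟩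

theorem clip_eq_self {δ x : ℝ} (hx : |x| ≤ δ) : clip δ x = x := by
  rw [clip, min_eq_right (abs_le.1 hx).2, max_eq_right (abs_le.1 hx).1]

/-- The value of the zeroth coordinate after `k` steps of the absorption process. -/
noncomputable def absorbSeq (x : ℕ → ℝ) : ℕ → ℝ
  | 0 => x 0
  | k + 1 => absorbSeq x k - clip (2 * (1 / 2) ^ k) (x (k + 1) + absorbSeq x k)

theorem continuous_absorbSeq (k : ℕ) : Continuous fun x => absorbSeq x k := by
  induction k with
  | zero => exact continuous_apply 0
  | succ k ih =>
    exact ih.sub ((continuous_clip _).comp ((continuous_apply _).add ih))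

theorem norm_clip_le (k : ℕ) (x : ℝ) : ‖clip (2 * (1 / 2) ^ k) x‖ ≤ 2 * (1 / 2) ^ k :=
  abs_clip_le (by positivity) x

theorem summable_two_mul_half_pow : Summable fun k : ℕ => 2 * (1 / 2 : ℝ) ^ k :=
  summable_geometric_two.mul_left 2

theorem summable_clip (y : ℕ → ℝ) : Summable fun k => clip (2 * (1 / 2) ^ k) (y k) :=
  .of_norm_bounded summable_two_mul_half_pow fun k => norm_clip_le k _

/-- A homeomorphism of `ℝ^ℕ` which sends the cube `∏ [-2⁻ᵏ, 2⁻ᵏ]` into the hyperplane where the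
zeroth coordinate vanishes. -/
noncomputable def absorb : (ℕ → ℝ) ≃ₜ (ℕ → ℝ) where
  toFun x k := match k with
    | 0 => x 0 - ∑' k, clip (2 * (1 / 2) ^ k) (x (k + 1) + absorbSeq x k)
    | k + 1 => x (k + 1) + absorbSeq x k
  invFun y k := match k with
    | 0 => y 0 + ∑' j, clip (2 * (1 / 2) ^ j) (y (j + 1))
    | k + 1 => y (k + 1) - (y 0 + ∑' j, clip (2 * (1 / 2) ^ (j + k)) (y (j + k + 1)))
  left_inv x := by
    have hs := summable_clip fun k => x (k + 1) + absorbSeq x k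
    have key : ∀ k, absorbSeq x k =
        x 0 - ∑ i ∈ Finset.range k, clip (2 * (1 / 2) ^ i) (x (i + 1) + absorbSeq x i) := by
      intro k
      induction k with
      | zero => simp [absorbSeq]
      | succ k ih => rw [Finset.sum_range_succ, ← sub_sub, ← ih, absorbSeq]
    funext k
    cases k with
    | zero => simp
    | succ k =>
      have := hs.sum_add_tsum_nat_add k
      simp only
      linarith [key k]
  right_inv y := by
    have hs := summable_clip fun k => y (k + 1)
    set x : ℕ → ℝ := fun k => match k with
      | 0 => y 0 + ∑' j, clip (2 * (1 / 2) ^ j) (y (j + 1))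
      | k + 1 => y (k + 1) - (y 0 + ∑' j, clip (2 * (1 / 2) ^ (j + k)) (y (j + k + 1))) with hx
    have key : ∀ k, absorbSeq x k =
        y 0 + ∑' j, clip (2 * (1 / 2) ^ (j + k)) (y (j + k + 1)) := by
      intro k
      induction k with
      | zero => simp [absorbSeq, hx]
      | succ k ih =>
        have e : x (k + 1) + absorbSeq x k = y (k + 1) := by rw [ih]; simp [hx]
        have e1 := hs.sum_add_tsum_nat_add k
        have e2 := hs.sum_add_tsum_nat_add (k + 1)
        rw [Finset.sum_range_succ] at e2
        rw [absorbSeq, e, ih]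
        linarith
    have e : ∀ k, x (k + 1) + absorbSeq x k = y (k + 1) := fun k => by rw [key]; simp [hx]
    funext k
    cases k with
    | zero =>
      change x 0 - ∑' k, clip (2 * (1 / 2) ^ k) (x (k + 1) + absorbSeq x k) = y 0
      simp only [e]
      simp [hx]
    | succ k => exact e k
  continuous_toFun := by
    refine continuous_pi fun k => ?_
    cases k with
    | zero =>
      exact (continuous_apply 0).sub (continuous_tsum
        (fun k => (continuous_clip _).comp ((continuous_apply _).add (continuous_absorbSeq k)))
        summable_two_mul_half_pow fun k x => norm_clip_le k _)
    | succ k => exact (continuous_apply _).add (continuous_absorbSeq k)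
  continuous_invFun := by
    refine continuous_pi fun k => ?_
    cases k with
    | zero =>
      exact (continuous_apply 0).add (continuous_tsum
        (fun k => (continuous_clip _).comp (continuous_apply _))
        summable_two_mul_half_pow fun k x => norm_clip_le k _)
    | succ k =>
      exact (continuous_apply _).sub ((continuous_apply 0).add (continuous_tsum
        (fun k => (continuous_clip _).comp (continuous_apply _))
        ((summable_nat_add_iff k).2 summable_two_mul_half_pow) fun j x => norm_clip_le _ _))

theorem absorb_apply_zero {x : ℕ → ℝ} (hx : ∀ k, |x k| ≤ (1 / 2) ^ k) : absorb x 0 = 0 := by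
  have half : ∀ k : ℕ, (1 / 2 : ℝ) ^ (k + 1) ≤ (1 / 2) ^ k := fun k =>
    pow_le_pow_of_le_one (by norm_num) (by norm_num) k.le_succ
  have key : ∀ k, |absorbSeq x k| ≤ (1 / 2) ^ k := by
    intro k
    induction k with
    | zero => exact hx 0
    | succ k ih =>
      rw [absorbSeq, clip_eq_self]
      · rw [show absorbSeq x k - (x (k + 1) + absorbSeq x k) = -x (k + 1) by ring, abs_neg]
        exact hx _
      · linarith [abs_add_le (x (k + 1)) (absorbSeq x k), hx (k + 1), half k]
  have sum : ∀ k, absorbSeq x k =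
      x 0 - ∑ i ∈ Finset.range k, clip (2 * (1 / 2) ^ i) (x (i + 1) + absorbSeq x i) := by
    intro k
    induction k with
    | zero => simp [absorbSeq]
    | succ k ih => rw [Finset.sum_range_succ, ← sub_sub, ← ih, absorbSeq]
  have t1 : Filter.Tendsto (absorbSeq x) Filter.atTop (𝓝 0) :=
    squeeze_zero_norm key (tendsto_pow_atTop_nhds_zero_of_lt_one (by norm_num) (by norm_num))
  have t2 : Filter.Tendsto (absorbSeq x) Filter.atTop (𝓝 (absorb x 0)) := by
    rw [funext sum]
    exact tendsto_const_nhds.sub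
      (summable_clip fun k => x (k + 1) + absorbSeq x k).hasSum.tendsto_sum_nat
  exact tendsto_nhds_unique t2 t1

/-- A homeomorphism `c` of `ℝ^K` acts on `ℝ^A` through a disjoint family of copies of `K`. -/
noncomputable def rowwise {A J K : Type*} (ι : J × K → A) (hι : Function.Injective ι)
    (c : (K → ℝ) ≃ₜ (K → ℝ)) : (A → ℝ) ≃ₜ (A → ℝ) where
  toFun y := Function.extend ι (fun p => c (fun k => y (ι (p.1, k))) p.2) y
  invFun y := Function.extend ι (fun p => c.symm (fun k => y (ι (p.1, k))) p.2) y
  left_inv y := by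
    funext i
    by_cases hi : ∃ p, ι p = i
    · obtain ⟨p, rfl⟩ := hi
      simp [hι.extend_apply]
    · simp [Function.extend_apply' _ _ _ hi]
  right_inv y := by
    funext i
    by_cases hi : ∃ p, ι p = i
    · obtain ⟨p, rfl⟩ := hi
      simp [hι.extend_apply]
    · simp [Function.extend_apply' _ _ _ hi]
  continuous_toFun := by
    refine continuous_pi fun i => ?_
    by_cases hi : ∃ p, ι p = i
    · obtain ⟨p, rfl⟩ := hi
      simp only [hι.extend_apply]
      fun_prop
    · simp only [Function.extend_apply' _ _ _ hi]
      fun_prop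
  continuous_invFun := by
    refine continuous_pi fun i => ?_
    by_cases hi : ∃ p, ι p = i
    · obtain ⟨p, rfl⟩ := hi
      simp only [hι.extend_apply]
      fun_prop
    · simp only [Function.extend_apply' _ _ _ hi]
      fun_prop

end Absorb

section Squeeze

open scoped Classical in
/-- Multiply the `V`-coordinates by `s`. -/
noncomputable def dilate {P A : Type*} (V : Set A) (s : ℝ) (w : P × (A → ℝ)) : P × (A → ℝ) :=
  (w.1, fun i => if i ∈ V then s * w.2 i else w.2 i)

open scoped Classical in
/-- Multiply the `V`-coordinates by `s` and divide the coordinate `t` by `s`. -/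
noncomputable def hyperbolic {P A : Type*} (V : Set A) (t : A) (s : ℝ) (w : P × (A → ℝ)) :
    P × (A → ℝ) :=
  (w.1, fun i => if i ∈ V then s * w.2 i else if i = t then s⁻¹ * w.2 i else w.2 i)

theorem dilate_dilate {P A : Type*} (V : Set A) (r s : ℝ) (w : P × (A → ℝ)) :
    dilate V r (dilate V s w) = dilate V (r * s) w := by
  refine Prod.ext rfl (funext fun i => ?_)
  by_cases hi : i ∈ V <;> simp [dilate, hi, mul_assoc]

theorem dilate_one {P A : Type*} (V : Set A) (w : P × (A → ℝ)) : dilate V 1 w = w := by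
  refine Prod.ext rfl (funext fun i => ?_)
  simp [dilate]

theorem hyperbolic_hyperbolic {P A : Type*} (V : Set A) (t : A) (r s : ℝ) (w : P × (A → ℝ)) :
    hyperbolic V t r (hyperbolic V t s w) = hyperbolic V t (r * s) w := by
  refine Prod.ext rfl (funext fun i => ?_)
  by_cases hi : i ∈ V
  · simp [hyperbolic, hi, mul_assoc]
  · rcases eq_or_ne i t with rfl | h
    · simp only [hyperbolic, hi, if_false, if_true, mul_inv]
      ring
    · simp [hyperbolic, hi, h]

theorem hyperbolic_one {P A : Type*} (V : Set A) (t : A) (w : P × (A → ℝ)) :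
    hyperbolic V t 1 w = w := by
  refine Prod.ext rfl (funext fun i => ?_)
  simp [hyperbolic]

theorem continuous_dilate {P A : Type*} [TopologicalSpace P] (V : Set A) :
    Continuous fun p : ℝ × (P × (A → ℝ)) => dilate V p.1 p.2 := by
  refine (continuous_fst.comp continuous_snd).prodMk (continuous_pi fun i => ?_)
  by_cases hi : i ∈ V <;> simp only [hi, if_true, if_false] <;> fun_prop

theorem Continuous.hyperbolic {P A : Type*} [TopologicalSpace P] (V : Set A) (t : A)
    {s : P × (A → ℝ) → ℝ} (hs : Continuous s) (h0 : ∀ w, s w ≠ 0) :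
    Continuous fun w : P × (A → ℝ) => hyperbolic V t (s w) w := by
  have hs' := hs.inv₀ h0
  refine continuous_fst.prodMk (continuous_pi fun i => ?_)
  by_cases hi : i ∈ V
  · simp only [hi, if_true]; fun_prop
  · rcases eq_or_ne i t with rfl | h
    · simp only [hi, if_true, if_false]; fun_prop
    · simp only [hi, h, if_false]; fun_prop

/-- The least radially monotone majorant of `1 - u`. -/
theorem exists_radial_majorant {P A : Type*} [TopologicalSpace P] (V : Set A)
    (u : P × (A → ℝ) → ℝ) (hu : Continuous u) (hu01 : ∀ w, u w ∈ Icc (0 : ℝ) 1)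
    (hu1 : ∀ w, (∀ i ∈ V, w.2 i = 0) → u w = 1) :
    ∃ μ : P × (A → ℝ) → ℝ, Continuous μ ∧ (∀ w, 0 ≤ μ w) ∧ (∀ w, 1 - u w ≤ μ w) ∧
      (∀ w, μ (dilate V 0 w) = 0) ∧
      (∀ r s w, 0 ≤ r → r ≤ s → μ (dilate V r w) ≤ μ (dilate V s w)) ∧
      ∀ M : Set A,
        (∀ w w', w.1 = w'.1 → (∀ i ∈ M, w.2 i = w'.2 i) → u w = u w') →
        ∀ w w', w.1 = w'.1 → (∀ i ∈ M, w.2 i = w'.2 i) → μ w = μ w' := by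
  let μ : P × (A → ℝ) → ℝ := fun w =>
    sSup ((fun σ : ℝ => 1 - u (dilate V σ w)) '' Icc 0 1)
  have hbdd : ∀ w, BddAbove ((fun σ : ℝ => 1 - u (dilate V σ w)) '' Icc 0 1) := by
    rintro w
    refine ⟨1, ?_⟩
    rintro _ ⟨σ, -, rfl⟩
    linarith [(hu01 (dilate V σ w)).1]
  have hle : ∀ w σ, σ ∈ Icc (0 : ℝ) 1 → 1 - u (dilate V σ w) ≤ μ w := fun w σ hσ =>
    le_csSup (hbdd w) ⟨σ, hσ, rfl⟩
  have hne : ∀ w, ((fun σ : ℝ => 1 - u (dilate V σ w)) '' Icc 0 1).Nonempty := fun w =>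
    ⟨_, 0, by simp, rfl⟩
  have hmono : ∀ r s w, 0 ≤ r → r ≤ s → μ (dilate V r w) ≤ μ (dilate V s w) := by
    intro r s w hr hrs
    refine csSup_le (hne _) ?_
    rintro _ ⟨σ, hσ, rfl⟩
    rcases hr.eq_or_lt with rfl | hr
    · have := hle (dilate V s w) 0 (by simp)
      simpa [dilate_dilate] using this
    · have hs : 0 < s := hr.trans_le hrs
      have := hle (dilate V s w) (σ * r / s)
        ⟨by have := hσ.1; positivity, by
          rw [div_le_one hs]; nlinarith [hσ.1, hσ.2]⟩
      rw [dilate_dilate, div_mul_cancel₀ _ hs.ne'] at this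
      simpa only [dilate_dilate] using this
  refine ⟨μ, ?_, fun w => ?_, fun w => ?_, fun w => ?_, hmono, fun M hM w w' hw1 hw => ?_⟩
  · have hc : Continuous fun p : (P × (A → ℝ)) × ℝ => 1 - u (dilate V p.2 p.1) :=
      continuous_const.sub (hu.comp ((continuous_dilate V).comp continuous_swap))
    exact isCompact_Icc.continuous_sSup hc
  · exact le_trans (by linarith [(hu01 (dilate V 0 w)).2]) (hle w 0 (by simp))
  · simpa [dilate_one] using hle w 1 (by simp)
  · have : (fun σ : ℝ => 1 - u (dilate V σ (dilate V 0 w))) = fun _ => 0 := by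
      funext σ
      rw [hu1, sub_self]
      intro i hi
      simp [dilate, hi]
    simp only [μ, this]
    rw [(nonempty_Icc.2 zero_le_one).image_const, csSup_singleton]
  · have : ∀ σ, u (dilate V σ w) = u (dilate V σ w') := fun σ =>
      hM _ _ hw1 fun i hi => by simp [dilate, hw i hi]
    simp only [μ, this]

/-- If `u` takes the value `1` where the `V`-coordinates vanish, then some homeomorphism acting on
the coordinates in `V ∪ {t}` makes the coordinate `t` small on the zero set of `u`. -/
theorem exists_squeeze {P A : Type*} [TopologicalSpace P] (V : Set A) (t : A) (ht : t ∉ V)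
    (c : ℝ) (hc : 0 ≤ c)
    (u : P × (A → ℝ) → ℝ) (hu : Continuous u) (hu01 : ∀ w, u w ∈ Icc (0 : ℝ) 1)
    (hu1 : ∀ w, (∀ i ∈ V, w.2 i = 0) → u w = 1)
    (hut : ∀ w w', w.1 = w'.1 → (∀ i ≠ t, w.2 i = w'.2 i) → u w = u w') :
    ∃ h : (P × (A → ℝ)) ≃ₜ (P × (A → ℝ)), (∀ w, (h w).1 = w.1) ∧
      (∀ w, ∀ i ∉ V, i ≠ t → (h w).2 i = w.2 i) ∧
      (∀ w, u w = 0 → c * |(h w).2 t| ≤ 1) ∧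
      ∀ M : Set A, t ∈ M →
        (∀ w w', w.1 = w'.1 → (∀ i ∈ M, w.2 i = w'.2 i) → u w = u w') →
        ∀ w w', w.1 = w'.1 → (∀ i ∈ M, w.2 i = w'.2 i) → ∀ i ∈ M, (h w).2 i = (h w').2 i := by
  obtain ⟨μ, μc, μ0, μu, μz, μm, μd⟩ := exists_radial_majorant V u hu hu01 hu1
  have μt : ∀ w w', w.1 = w'.1 → (∀ i ≠ t, w.2 i = w'.2 i) → μ w = μ w' := fun w w' h1 h2 =>
    μd {t}ᶜ hut w w' h1 h2
  let G : ℝ → P × (A → ℝ) → ℝ := fun s w => s + c * |w.2 t| * μ (dilate V s w)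
  have Gc : Continuous fun p : ℝ × (P × (A → ℝ)) => G p.1 p.2 := by
    have h : Continuous fun p : ℝ × (P × (A → ℝ)) => c * |p.2.2 t| := by fun_prop
    exact continuous_fst.add (h.mul (μc.comp (continuous_dilate V)))
  have Gmono : ∀ r s w, 0 ≤ r → r < s → G r w < G s w := fun r s w hr hrs =>
    add_lt_add_of_lt_of_le hrs (mul_le_mul_of_nonneg_left (μm r s w hr hrs.le) (by positivity))
  have G0 : ∀ w, G 0 w = 0 := fun w => by simp [G, μz]
  have G1 : ∀ w, 1 ≤ G 1 w := fun w => by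
    have := μ0 (dilate V 1 w)
    have : 0 ≤ c * |w.2 t| * μ (dilate V 1 w) := by positivity
    simp only [G]
    linarith
  have hroot : ∀ w, ∃ s, 0 < s ∧ G s w = 1 := by
    intro w
    have hcont : ContinuousOn (fun s => G s w) (Icc 0 1) :=
      (Gc.comp (continuous_id.prodMk continuous_const)).continuousOn
    obtain ⟨s, hs, hs1⟩ := intermediate_value_Icc zero_le_one hcont
      (show (1 : ℝ) ∈ Icc (G 0 w) (G 1 w) from ⟨by rw [G0]; exact zero_le_one, G1 w⟩)
    refine ⟨s, hs.1.lt_of_ne ?_, hs1⟩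
    rintro rfl
    simp only [G0] at hs1
    exact zero_ne_one hs1
  choose ρ ρ0 ρ1 using hroot
  have Glt : ∀ s w, 0 ≤ s → (ρ w < s ↔ 1 < G s w) := by
    intro s w hs
    refine ⟨fun h => ρ1 w ▸ Gmono _ _ w (ρ0 w).le h, fun h => ?_⟩
    by_contra! hle
    rcases hle.eq_or_lt with rfl | hlt
    · exact h.ne' (ρ1 w)
    · exact (h.trans (ρ1 w ▸ Gmono s _ w hs hlt)).false
  have Ggt : ∀ s w, 0 ≤ s → (s < ρ w ↔ G s w < 1) := by
    intro s w hs
    refine ⟨fun h => ρ1 w ▸ Gmono _ _ w hs h, fun h => ?_⟩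
    by_contra! hle
    rcases hle.eq_or_lt with rfl | hlt
    · exact h.ne (ρ1 w)
    · exact (h.trans (ρ1 w ▸ Gmono _ s w (ρ0 w).le hlt)).false
  have ρuniq : ∀ s w, 0 ≤ s → G s w = 1 → ρ w = s := fun s w hs h =>
    le_antisymm (not_lt.1 fun hh => h.not_lt ((Ggt s w hs).1 hh))
      (not_lt.1 fun hh => h.not_gt ((Glt s w hs).1 hh))
  have Gcs : ∀ s, Continuous (G s) := fun s =>
    Gc.comp (continuous_const.prodMk continuous_id)
  have ρc : Continuous ρ := by
    rw [OrderTopology.continuous_iff]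
    intro a
    rcases lt_or_ge a 0 with ha | ha
    · constructor
      · convert isOpen_univ
        exact eq_univ_of_forall fun w => ha.trans (ρ0 w)
      · convert isOpen_empty
        exact eq_empty_of_forall_notMem fun w hw => (ha.trans (ρ0 w)).not_gt hw
    · constructor
      · convert isOpen_lt (Gcs a) (continuous_const (y := (1 : ℝ))) using 1
        exact Set.ext fun w => Ggt a w ha
      · convert isOpen_lt (continuous_const (y := (1 : ℝ))) (Gcs a) using 1
        exact Set.ext fun w => Glt a w ha
  let lam : P × (A → ℝ) → ℝ := fun w => 1 + c * |w.2 t| * μ w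
  have lam1 : ∀ w, 1 ≤ lam w := fun w => by
    have := μ0 w
    exact le_add_of_nonneg_right (by positivity)
  have lam0 : ∀ w, 0 < lam w := fun w => zero_lt_one.trans_le (lam1 w)
  have lamc : Continuous lam := by simp only [lam]; fun_prop
  have μhyp : ∀ s w, μ (hyperbolic V t s w) = μ (dilate V s w) := fun s w =>
    μt _ _ rfl fun i hi => by simp [hyperbolic, dilate, hi]
  have thyp : ∀ (s : ℝ) (w : P × (A → ℝ)), (hyperbolic V t s w).2 t = s⁻¹ * w.2 t := fun s w => by
    simp [hyperbolic, ht]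
  refine ⟨⟨⟨fun w => hyperbolic V t (lam w) w, fun w => hyperbolic V t (ρ w) w, fun w => ?_,
    fun w => ?_⟩, lamc.hyperbolic V t fun w => (lam0 w).ne', ρc.hyperbolic V t fun w => (ρ0 w).ne'⟩,
    fun w => rfl, fun w i hi hit => ?_, fun w hw => ?_, fun M htM hM w w' hw1 hw i hi => ?_⟩
  · have e : ρ (hyperbolic V t (lam w) w) = (lam w)⁻¹ := by
      refine ρuniq _ _ (inv_nonneg.2 (lam0 w).le) ?_
      have : μ (dilate V (lam w)⁻¹ (hyperbolic V t (lam w) w)) = μ w := by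
        refine μt _ _ rfl fun i hi => ?_
        by_cases hV : i ∈ V <;> simp [dilate, hyperbolic, hV, hi, (lam0 w).ne']
      simp only [G]
      rw [this, thyp, abs_mul, abs_of_pos (inv_pos.2 (lam0 w))]
      have : (lam w)⁻¹ * lam w = 1 := inv_mul_cancel₀ (lam0 w).ne'
      calc _ = (lam w)⁻¹ * lam w := by simp only [lam]; ring
        _ = 1 := this
    simp only
    rw [e, hyperbolic_hyperbolic, inv_mul_cancel₀ (lam0 w).ne', hyperbolic_one]
  · have e : lam (hyperbolic V t (ρ w) w) = (ρ w)⁻¹ := by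
      have h := ρ1 w
      have hp := ρ0 w
      simp only [lam, G] at h ⊢
      rw [μhyp, thyp, abs_mul, abs_of_pos (inv_pos.2 hp)]
      field_simp
      linarith
    simp only
    rw [e, hyperbolic_hyperbolic, inv_mul_cancel₀ (ρ0 w).ne', hyperbolic_one]
  · change (hyperbolic V t (lam w) w).2 i = _
    simp [hyperbolic, hi, hit]
  · change c * |(hyperbolic V t (lam w) w).2 t| ≤ 1
    have hμ : 1 ≤ μ w := by have := μu w; rwa [hw, sub_zero] at this
    rw [thyp, abs_mul, abs_of_pos (inv_pos.2 (lam0 w)), mul_left_comm, inv_mul_le_iff₀ (lam0 w),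
      mul_one]
    have : c * |w.2 t| ≤ c * |w.2 t| * μ w := le_mul_of_one_le_right (by positivity) hμ
    simp only [lam]
    linarith
  · change (hyperbolic V t (lam w) w).2 i = (hyperbolic V t (lam w') w').2 i
    have : lam w = lam w' := by simp only [lam, hw t htM, μd M hM w w' hw1 hw]
    simp [hyperbolic, this, hw i hi]

end Squeeze

section Unknotting

/-- Two equipotent disjoint sets are interchanged by a permutation fixing all other points. -/
theorem exists_perm_swap {A : Type*} {K E : Set A} (hKE : Disjoint K E) (e : K ≃ E) :
    ∃ σ : A ≃ A, (∀ i ∈ E, σ i ∈ K) ∧ ∀ i, i ∉ K → i ∉ E → σ i = i := by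
  classical
  let s : A → A := fun i =>
    if h : i ∈ K then e ⟨i, h⟩ else if h : i ∈ E then e.symm ⟨i, h⟩ else i
  have hE : ∀ {i}, i ∈ E → i ∉ K := fun hi hk => hKE.le_bot ⟨hk, hi⟩
  have sK : ∀ {i} (h : i ∈ K), s i = e ⟨i, h⟩ := fun h => dif_pos h
  have sE : ∀ {i} (h : i ∈ E), s i = e.symm ⟨i, h⟩ := fun h => by
    simp only [s, dif_neg (hE h), dif_pos h]
  have s0 : ∀ {i}, i ∉ K → i ∉ E → s i = i := fun h h' => by
    simp only [s, dif_neg h, dif_neg h']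
  have hs : Function.Involutive s := by
    intro i
    by_cases hK : i ∈ K
    · rw [sK hK, sE (Subtype.coe_prop _)]; simp
    · by_cases hE : i ∈ E
      · rw [sE hE, sK (Subtype.coe_prop _)]; simp
      · rw [s0 hK hE, s0 hK hE]
  refine ⟨hs.toPerm s, fun i hi => ?_, fun i h h' => s0 h h'⟩
  change s i ∈ K
  rw [sE hi]
  exact Subtype.coe_prop _

/-- Klee's trick: a fiberwise homeomorphism between sets contained in complementary coordinate
subspaces extends to the whole space. -/
theorem exists_extension_of_complementary {P A : Type*} [TopologicalSpace P] {K E : Set A}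
    (hKE : Disjoint K E) {Z F : Set (P × (A → ℝ))} {f g : P × (A → ℝ) → P × (A → ℝ)}
    (hf : Continuous f) (hg : Continuous g) (hf1 : ∀ w, (f w).1 = w.1)
    (hfix : ∀ w i, i ∉ K → i ∉ E → (f w).2 i = w.2 i)
    (hfZ : ∀ z ∈ Z, f z ∈ F) (hgf : ∀ z ∈ Z, g (f z) = z)
    (hZ : ∀ z ∈ Z, ∀ i ∈ K, z.2 i = 0) (hF : ∀ z ∈ F, ∀ i ∈ E, z.2 i = 0) :
    ∃ H : (P × (A → ℝ)) ≃ₜ (P × (A → ℝ)), (∀ w, (H w).1 = w.1) ∧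
      (∀ w i, i ∉ K → i ∉ E → (H w).2 i = w.2 i) ∧ ∀ z ∈ Z, H z = f z := by
  have hproj : ∀ S : Set A, Continuous fun w : P × (A → ℝ) => (w.1, Sᶜ.indicator w.2) := by
    intro S
    refine continuous_fst.prodMk (continuous_pi fun i => ?_)
    by_cases hi : i ∈ S <;> simp only [Set.indicator, mem_compl_iff, hi, not_true, not_false_iff,
      if_true, if_false] <;> fun_prop
  have hpd : ∀ (S : Set A) (w w' : P × (A → ℝ)), w.1 = w'.1 → (∀ i ∉ S, w.2 i = w'.2 i) →
      (w.1, Sᶜ.indicator w.2) = (w'.1, Sᶜ.indicator w'.2) := by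
    intro S w w' h1 h2
    refine Prod.ext h1 (funext fun i => ?_)
    by_cases hi : i ∈ S
    · simp [hi]
    · simp [hi, h2 i hi]
  let H₁ := shear K (fun w => (f (w.1, Kᶜ.indicator w.2)).2)
    (continuous_snd.comp (hf.comp (hproj K)))
    (fun w w' h1 h2 => by rw [hpd K w w' h1 h2])
  let H₂ := shear E (fun w => -(g (w.1, Eᶜ.indicator w.2)).2)
    (continuous_snd.comp (hg.comp (hproj E))).neg
    (fun w w' h1 h2 => by rw [hpd E w w' h1 h2])
  have e₁ : ∀ w i, (H₁ w).2 i = w.2 i + K.indicator (f (w.1, Kᶜ.indicator w.2)).2 i :=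
    fun w i => rfl
  have e₂ : ∀ w i, (H₂ w).2 i = w.2 i + E.indicator (-(g (w.1, Eᶜ.indicator w.2)).2) i :=
    fun w i => rfl
  refine ⟨H₁.trans H₂, fun w => rfl, fun w i hK hE => ?_, fun z hz => ?_⟩
  · rw [Homeomorph.trans_apply, e₂, e₁]
    simp [hK, hE]
  · have p₁ : (z.1, Kᶜ.indicator z.2) = z := by
      refine Prod.ext rfl (funext fun i => ?_)
      by_cases hi : i ∈ K
      · simp [hi, hZ z hz i hi]
      · simp [hi]
    have p₂ : ((H₁ z).1, Eᶜ.indicator (H₁ z).2) = f z := by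
      refine Prod.ext (hf1 z).symm (funext fun i => ?_)
      by_cases hE : i ∈ E
      · simp [hE, hF _ (hfZ z hz) i hE]
      · change Eᶜ.indicator (H₁ z).2 i = _
        rw [Set.indicator_of_mem (show i ∈ Eᶜ from hE), e₁, p₁]
        by_cases hK : i ∈ K
        · simp [hK, hZ z hz i hK]
        · simp [hK, hfix z i hK hE]
    refine Prod.ext (hf1 z).symm (funext fun i => ?_)
    rw [Homeomorph.trans_apply, e₂, p₂, hgf z hz]
    by_cases hE : i ∈ E
    · have hK : i ∉ K := fun hk => hKE.le_bot ⟨hk, hE⟩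
      rw [e₁]
      simp [hE, hK, hF _ (hfZ z hz) i hE]
    · have := congrFun (congrArg Prod.snd p₂) i
      simp only [Set.indicator_of_mem (show i ∈ Eᶜ from hE)] at this
      simp [hE, this]

theorem continuous_resToP {A : Type u} (D : Set A) : Continuous (resToP D) := by
  unfold resToP resTo
  fun_prop

/-- If the projection of `Z` to the level `L₁` is functionally separated from the image of a
fiberwise map that is invariant over the level `L₀`, then some fiberwise homeomorphism acting
between `L₀` and `L₂` makes a coordinate `t ∈ L₂ \ L₁` small on `Z`. -/
theorem exists_squeeze_of_separated {A : Type u} {L₀ L₁ L₂ : Set A} (h01 : L₀ ⊆ L₁)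
    (h12 : L₁ ⊆ L₂) {t : A} (ht : t ∈ L₂ \ L₁) {c : ℝ} (hc : 0 ≤ c)
    (φ : (↥L₁ → ℝ) × (↥L₁ → ℝ) → (↥L₁ → ℝ) × (↥L₁ → ℝ)) (hφc : Continuous φ)
    (hφ1 : ∀ x, (φ x).1 = x.1) (hφinv : ∀ x, resSubP h01 (φ x) = resSubP h01 x)
    {Z : Set ((A → ℝ) × (A → ℝ))}
    (hsep : FunctionallySeparated (resToP L₁ '' Z) (Set.range φ)) :
    ∃ h : ((A → ℝ) × (A → ℝ)) ≃ₜ ((A → ℝ) × (A → ℝ)), (∀ w, (h w).1 = w.1) ∧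
      (∀ w, ∀ i ∉ L₂ \ L₀, (h w).2 i = w.2 i) ∧
      (∀ w w', w.1 = w'.1 → (∀ i ∈ L₂, w.2 i = w'.2 i) →
        ∀ i ∈ L₂, (h w).2 i = (h w').2 i) ∧
      ∀ z ∈ Z, c * |(h z).2 t| ≤ 1 := by
  classical
  obtain ⟨u, uc, u01, uZ, uφ⟩ := hsep
  let base : (A → ℝ) × (A → ℝ) → (A → ℝ) × (A → ℝ) := fun w => (w.1, L₀.indicator w.2)
  have base_c : Continuous base := by
    refine continuous_fst.prodMk (continuous_pi fun i => ?_)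
    by_cases hi : i ∈ L₀ <;> simp only [Set.indicator, hi, if_true, if_false] <;> fun_prop
  have base_congr : ∀ w w' : (A → ℝ) × (A → ℝ), w.1 = w'.1 → (∀ i ∈ L₀, w.2 i = w'.2 i) →
      base w = base w' := by
    intro w w' h1 h2
    refine Prod.ext h1 (funext fun i => ?_)
    by_cases hi : i ∈ L₀
    · simp [base, hi, h2 i hi]
    · simp [base, hi]
  let p : (A → ℝ) × (A → ℝ) → A → ℝ := fun w i =>
    if h : i ∈ L₁ then (φ (resToP L₁ (base w))).2 ⟨i, h⟩ else 0
  have pc : Continuous p := by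
    have := hφc.comp ((continuous_resToP L₁).comp base_c)
    refine continuous_pi fun i => ?_
    by_cases hi : i ∈ L₁
    · simp only [p, hi, dif_pos]
      exact (continuous_apply _).comp (continuous_snd.comp this)
    · simp only [p, hi]
      exact continuous_const
  have p_congr : ∀ w w' : (A → ℝ) × (A → ℝ), w.1 = w'.1 → (∀ i ∈ L₀, w.2 i = w'.2 i) →
      p w = p w' := fun w w' h1 h2 => by
    simp only [p, base_congr w w' h1 h2]
  let τ := shear (L₁ \ L₀) p pc fun w w' h1 h2 =>
    p_congr w w' h1 fun i hi => h2 i fun hh => hh.2 hi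
  have eτ : ∀ w i, (τ w).2 i = w.2 i + (L₁ \ L₀).indicator (p w) i := fun w i => rfl
  have eτs : ∀ w i, (τ.symm w).2 i = w.2 i - (L₁ \ L₀).indicator (p w) i := fun w i => rfl
  have u'_congr : ∀ M : Set A, L₁ ⊆ M → ∀ w w', w.1 = w'.1 → (∀ i ∈ M, w.2 i = w'.2 i) →
      u (resToP L₁ (τ w)) = u (resToP L₁ (τ w')) := by
    intro M hM w w' h1 h2
    congr 1
    refine Prod.ext (funext fun i => congrFun h1 i) (funext fun i => ?_)
    change (τ w).2 i = (τ w').2 i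
    rw [eτ, eτ, h2 i (hM i.2), p_congr w w' h1 fun j hj => h2 j (hM (h01 hj))]
  obtain ⟨h, h1, hfix, hsmall, hdep⟩ := exists_squeeze (L₁ \ L₀) t (fun hh => ht.2 hh.1) c hc
    (fun w => u (resToP L₁ (τ w))) (uc.comp ((continuous_resToP L₁).comp τ.continuous))
    (fun w => u01 _) (fun w hw => by
      refine uφ _ ⟨resToP L₁ (base w), Prod.ext (hφ1 _) (funext fun i => ?_)⟩
      change _ = (τ w).2 i
      rw [eτ]
      by_cases hi : i.1 ∈ L₀
      · have := congrFun (congrArg Prod.snd (hφinv (resToP L₁ (base w)))) ⟨i, hi⟩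
        simp only [resSubP] at this
        rw [Set.indicator_of_notMem (fun hh => hh.2 hi), add_zero]
        exact this.trans (Set.indicator_of_mem hi _)
      · have hi' : i.1 ∈ L₁ \ L₀ := ⟨i.2, hi⟩
        rw [Set.indicator_of_mem hi', hw i hi', zero_add]
        simp [p])
    (fun w w' h1 h2 => u'_congr {t}ᶜ (fun i hi hit => ht.2 (hit ▸ hi)) w w' h1 h2)
  refine ⟨τ.symm.trans h, fun w => h1 _, fun w i hi => ?_, fun w w' hw1 hw => ?_, fun z hz => ?_⟩
  · have hi' : i ∉ L₁ \ L₀ := fun hh => hi ⟨h12 hh.1, hh.2⟩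
    rw [Homeomorph.trans_apply, hfix _ i hi', eτs, Set.indicator_of_notMem hi', sub_zero]
    rintro rfl
    exact hi ⟨ht.1, fun hh => ht.2 (h01 hh)⟩
  · refine hdep L₂ ht.1 (u'_congr L₂ h12) _ _ hw1 fun i hi => ?_
    change (τ.symm w).2 i = (τ.symm w').2 i
    rw [eτs, eτs, hw i hi, p_congr w w' hw1 fun j hj => hw j (h12 (h01 hj))]
  · refine hsmall (τ.symm z) ?_
    simp only [Homeomorph.apply_symm_apply]
    exact uZ _ ⟨z, hz, rfl⟩

/-- A set whose projections to all levels are functionally separated from images of fiberwise maps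
can be moved by a fiberwise homeomorphism into a subspace of infinite codimension. -/
theorem exists_flattening {A : Type u} {B : Set A} {C : ℕ → Set A}
    (hCmono : ∀ n, C n ⊆ C (n + 1)) (hcover : B ∪ (⋃ n, C n) = Set.univ)
    {t : ℕ → A} (ht : ∀ k, t k ∈ (B ∪ C (2 * k + 2)) \ (B ∪ C (2 * k + 1)))
    (ht_inj : Function.Injective t)
    (φ : ∀ n, (↥(B ∪ C n) → ℝ) × (↥(B ∪ C n) → ℝ) → (↥(B ∪ C n) → ℝ) × (↥(B ∪ C n) → ℝ))
    (hφc : ∀ n, Continuous (φ n)) (hφ1 : ∀ n, 1 ≤ n → ∀ x, (φ n x).1 = x.1)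
    (hφinv : ∀ n, ∀ x, resSubP (Set.union_subset_union_right B (hCmono n)) (φ (n + 1) x) =
      resSubP (Set.union_subset_union_right B (hCmono n)) x)
    {Z : Set ((A → ℝ) × (A → ℝ))}
    (hsep : ∀ n, 1 ≤ n → FunctionallySeparated (resToP (B ∪ C n) '' Z) (Set.range (φ n))) :
    ∃ Φ : ((A → ℝ) × (A → ℝ)) ≃ₜ ((A → ℝ) × (A → ℝ)), (∀ w, (Φ w).1 = w.1) ∧
      (∀ w, ∀ b ∈ B, (Φ w).2 b = w.2 b) ∧
      ∀ z ∈ Z, ∀ j, (Φ z).2 (t (Nat.pair j 0)) = 0 := by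
  have hC : Monotone C := monotone_nat_of_le_succ hCmono
  have hstep := fun k => exists_squeeze_of_separated
    (Set.union_subset_union_right B (hCmono (2 * k)))
    (Set.union_subset_union_right B (hCmono (2 * k + 1))) (ht k) (c := 2 ^ k) (by positivity)
    (φ (2 * k + 1)) (hφc _) (hφ1 _ (by lia)) (hφinv (2 * k)) (hsep _ (by lia))
  choose h h1 hfix hdep hsmall using hstep
  obtain ⟨Θ, Θ1, Θ0, Θs⟩ := exists_homeomorph_of_tower (fun k => B ∪ C (2 * k))
    (fun m n hmn => Set.union_subset_union_right B (hC (by lia)))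
    (fun i => by
      rcases (hcover ▸ mem_univ i : i ∈ B ∪ ⋃ n, C n) with hi | hi
      · exact ⟨0, Or.inl hi⟩
      · obtain ⟨n, hn⟩ := mem_iUnion.1 hi
        exact ⟨n, Or.inr (hC (by lia) hn)⟩) h h1 hfix hdep
  let ι : ℕ × ℕ → A := fun p => t (Nat.pair p.1 p.2)
  have hι : Function.Injective ι := fun p q hpq => by
    have := Nat.pair_eq_pair.1 (ht_inj hpq)
    exact Prod.ext this.1 this.2
  refine ⟨Θ.trans ((Homeomorph.refl _).prodCongr (rowwise ι hι absorb)), fun w => Θ1 w,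
    fun w b hb => ?_, fun z hz j => ?_⟩
  · change Function.extend ι (fun p => absorb (fun k => (Θ w).2 (ι (p.1, k))) p.2) (Θ w).2 b = w.2 b
    rw [Function.extend_apply', Θ0 w b (Or.inl hb)]
    rintro ⟨p, rfl⟩
    exact (ht _).2 (Or.inl hb)
  · change Function.extend ι (fun p => absorb (fun k => (Θ z).2 (ι (p.1, k))) p.2) (Θ z).2
      (ι (j, 0)) = 0
    rw [hι.extend_apply]
    refine absorb_apply_zero fun k => ?_
    change |(Θ z).2 (t (Nat.pair j k))| ≤ _
    set n := Nat.pair j k with hn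
    rw [Θs n z (t n) ⟨(ht n).1, fun hh => (ht n).2
      (Set.union_subset_union_right B (hCmono (2 * n)) hh)⟩]
    have hs := hsmall n z hz
    rw [mul_comm, ← le_div_iff₀ (by positivity), ← one_div_pow] at hs
    exact hs.trans (pow_le_pow_of_le_one (by norm_num) (by norm_num) (Nat.right_le_pair j k))

end Unknotting

/-- Fiberwise unknotting in `ℝ^{B∪C} × ℝ^{B∪C}`: given fiber-preserving mutually inverse
maps `f, g` interchanging `Z` and `F`, and fiber-preserving level maps `φₙ, ψₙ` whose images
are functionally separated from the projections of `Z`, resp. `F`, the homeomorphism `f|Z`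
extends to an autohomeomorphism `H` with `π₁ ∘ H = π₁` and `(π_B × π_B) ∘ H = π_B × π_B`. -/
theorem fiberwise_limit_unknotting
    (A : Type u) (B : Set A)
    (Cseq : ℕ → Set A) (hCcount : ∀ n, (Cseq n).Countable)
    (hCmono : ∀ n, Cseq n ⊆ Cseq (n + 1)) (hC0 : Cseq 0 = ∅)
    (hcover : B ∪ (⋃ n, Cseq n) = Set.univ)
    (Z F : Set ((A → ℝ) × (A → ℝ))) (hZcl : IsClosed Z) (hFcl : IsClosed F)
    (φ ψ : ∀ n, (↥(B ∪ Cseq n) → ℝ) × (↥(B ∪ Cseq n) → ℝ) →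
      (↥(B ∪ Cseq n) → ℝ) × (↥(B ∪ Cseq n) → ℝ))
    (hφc : ∀ n, Continuous (φ n)) (hψc : ∀ n, Continuous (ψ n))
    (hφ1 : ∀ n, 1 ≤ n → ∀ x, (φ n x).1 = x.1)
    (hψ1 : ∀ n, 1 ≤ n → ∀ x, (ψ n x).1 = x.1)
    (hφinv : ∀ n, ∀ x, resSubP (Set.union_subset_union_right B (hCmono n)) (φ (n + 1) x) =
      resSubP (Set.union_subset_union_right B (hCmono n)) x)
    (hψinv : ∀ n, ∀ x, resSubP (Set.union_subset_union_right B (hCmono n)) (ψ (n + 1) x) =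
      resSubP (Set.union_subset_union_right B (hCmono n)) x)
    (hφsep : ∀ n, 1 ≤ n →
      FunctionallySeparated (resToP (B ∪ Cseq n) '' Z) (Set.range (φ n)))
    (hψsep : ∀ n, 1 ≤ n →
      FunctionallySeparated (resToP (B ∪ Cseq n) '' F) (Set.range (ψ n)))
    (f g : (A → ℝ) × (A → ℝ) → (A → ℝ) × (A → ℝ))
    (hfc : Continuous f) (hgc : Continuous g)
    (hfZ : f '' Z = F) (hgF : g '' F = Z)
    (hgf : ∀ z ∈ Z, g (f z) = z) (hfg : ∀ y ∈ F, f (g y) = y)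
    (hf1 : ∀ x, (f x).1 = x.1) (hg1 : ∀ x, (g x).1 = x.1)
    (hfB : ∀ x, resToP (B ∪ Cseq 0) (f x) = resToP (B ∪ Cseq 0) x)
    (hgB : ∀ x, resToP (B ∪ Cseq 0) (g x) = resToP (B ∪ Cseq 0) x) :
    ∃ H : ((A → ℝ) × (A → ℝ)) ≃ₜ ((A → ℝ) × (A → ℝ)),
      (∀ z ∈ Z, H z = f z) ∧ (∀ x, (H x).1 = x.1) ∧
      ∀ x, resToP B (H x) = resToP B x := by
  classical
  rcases Z.eq_empty_or_nonempty with rfl | ⟨z₀, hz₀⟩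
  · exact ⟨Homeomorph.refl _, fun z hz => hz.elim, fun x => rfl, fun x => rfl⟩
  have hC : Monotone Cseq := monotone_nat_of_le_succ hCmono
  have fixB : ∀ {w w' : (A → ℝ) × (A → ℝ)},
      resToP (B ∪ Cseq 0) w = resToP (B ∪ Cseq 0) w' → ∀ b ∈ B, w.2 b = w'.2 b :=
    fun h b hb => congrFun (congrArg Prod.snd h) ⟨b, Or.inl hb⟩
  have ht : ∀ k, ∃ a, a ∈ (B ∪ Cseq (2 * k + 2)) \ (B ∪ Cseq (2 * k + 1)) := by
    intro k
    by_contra! hne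
    obtain ⟨u, -, -, uZ, uφ⟩ := hφsep (2 * k + 2) (by lia)
    have e : φ (2 * k + 2) (resToP _ z₀) = resToP _ z₀ := by
      refine Prod.ext (hφ1 _ (by lia) _) (funext fun i => ?_)
      have hi : i.1 ∈ B ∪ Cseq (2 * k + 1) := by
        by_contra hi
        exact hne i ⟨i.2, hi⟩
      exact congrFun (congrArg Prod.snd (hφinv (2 * k + 1) (resToP _ z₀))) ⟨i, hi⟩
    have h0 := uZ _ ⟨z₀, hz₀, rfl⟩
    rw [uφ _ ⟨_, e⟩] at h0
    exact one_ne_zero h0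
  choose t ht using ht
  have ht_inj : Function.Injective t := by
    have hne : ∀ m n, m < n → t m ≠ t n := fun m n hmn hEq => (ht n).2 <| by
      rw [← hEq]
      exact Set.union_subset_union_right B (hC (by lia)) (ht m).1
    intro m n hEq
    rcases lt_trichotomy m n with h | h | h
    · exact (hne m n h hEq).elim
    · exact h
    · exact (hne n m h hEq.symm).elim
  have htB : ∀ k, t k ∉ B := fun k hk => (ht k).2 (Or.inl hk)
  obtain ⟨Φ, Φ1, ΦB, ΦZ⟩ := exists_flattening hCmono hcover ht ht_inj φ hφc hφ1 hφinv hφsep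
  obtain ⟨Ψ, Ψ1, ΨB, ΨF⟩ := exists_flattening hCmono hcover ht ht_inj ψ hψc hψ1 hψinv hψsep
  let K : Set A := Set.range fun j => t (Nat.pair j 0)
  let E : Set A := Bᶜ \ K
  have hKinf : K.Infinite := Set.infinite_range_of_injective fun i j hij =>
    (Nat.pair_eq_pair.1 (ht_inj hij)).1
  have hEinf : E.Infinite := by
    refine (Set.infinite_range_of_injective (f := fun j => t (Nat.pair j 1)) fun i j hij =>
      (Nat.pair_eq_pair.1 (ht_inj hij)).1).mono ?_
    rintro _ ⟨j, rfl⟩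
    refine ⟨htB _, ?_⟩
    rintro ⟨i, hi⟩
    exact zero_ne_one (Nat.pair_eq_pair.1 (ht_inj hi)).2
  have hEcount : E.Countable := by
    refine (Set.countable_iUnion hCcount).mono fun i hi => ?_
    exact (hcover ▸ mem_univ i : i ∈ B ∪ ⋃ n, Cseq n).resolve_left hi.1
  have hKE : Disjoint K E := Set.disjoint_sdiff_right
  have hKB : ∀ b ∈ B, b ∉ K := by
    rintro _ hb ⟨j, rfl⟩
    exact htB _ hb
  have hout : ∀ i, i ∉ K → i ∉ E → i ∈ B := fun i hK hE => by
    by_contra hi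
    exact hE ⟨hi, hK⟩
  have := hKinf.to_subtype
  have := hEinf.to_subtype
  have := (Set.countable_range fun j => t (Nat.pair j 0)).to_subtype
  have := hEcount.to_subtype
  obtain ⟨e⟩ : Nonempty (K ≃ E) := nonempty_equiv_of_countable
  obtain ⟨σ, σE, σ0⟩ := exists_perm_swap hKE e
  let Ψ' : ((A → ℝ) × (A → ℝ)) ≃ₜ ((A → ℝ) × (A → ℝ)) := Ψ.trans
    ((Homeomorph.refl _).prodCongr
      { toFun := fun y i => y (σ i)
        invFun := fun y i => y (σ.symm i)
        left_inv := fun y => by simp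
        right_inv := fun y => by simp
        continuous_toFun := by fun_prop
        continuous_invFun := by fun_prop })
  have S2 : ∀ w i, (Ψ' w).2 i = (Ψ w).2 (σ i) := fun w i => rfl
  have S1 : ∀ w, (Ψ' w).1 = w.1 := Ψ1
  have SB : ∀ w, ∀ b ∈ B, (Ψ' w).2 b = w.2 b := fun w b hb => by
    rw [S2, σ0 b (hKB b hb) fun hh => hh.1 hb, ΨB w b hb]
  have Φs1 : ∀ w, (Φ.symm w).1 = w.1 := fun w => by
    rw [← Φ1 (Φ.symm w), Φ.apply_symm_apply]
  have ΦsB : ∀ w, ∀ b ∈ B, (Φ.symm w).2 b = w.2 b := fun w b hb => by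
    rw [← ΦB (Φ.symm w) b hb, Φ.apply_symm_apply]
  have Ss1 : ∀ w, (Ψ'.symm w).1 = w.1 := fun w => by
    rw [← S1 (Ψ'.symm w), Ψ'.apply_symm_apply]
  have SsB : ∀ w, ∀ b ∈ B, (Ψ'.symm w).2 b = w.2 b := fun w b hb => by
    rw [← SB (Ψ'.symm w) b hb, Ψ'.apply_symm_apply]
  obtain ⟨H, H1, HB, HZ⟩ := exists_extension_of_complementary hKE (Z := Φ '' Z) (F := Ψ' '' F)
    (f := fun w => Ψ' (f (Φ.symm w))) (g := fun w => Φ (g (Ψ'.symm w)))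
    (Ψ'.continuous.comp (hfc.comp Φ.symm.continuous))
    (Φ.continuous.comp (hgc.comp Ψ'.symm.continuous))
    (fun w => by rw [S1, hf1, Φs1])
    (fun w i hK hE => by
      have hi := hout i hK hE
      rw [SB _ i hi, fixB (hfB _) i hi, ΦsB _ i hi])
    (by
      rintro _ ⟨z, hz, rfl⟩
      simp only [Homeomorph.symm_apply_apply]
      exact ⟨f z, hfZ ▸ mem_image_of_mem f hz, rfl⟩)
    (by
      rintro _ ⟨z, hz, rfl⟩
      simp only [Homeomorph.symm_apply_apply, hgf z hz])
    (by
      rintro _ ⟨z, hz, rfl⟩ _ ⟨j, rfl⟩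
      exact ΦZ z hz j)
    (by
      rintro _ ⟨y, hy, rfl⟩ i hi
      obtain ⟨j, hj⟩ := σE i hi
      rw [S2, ← hj]
      exact ΨF y hy j)
  refine ⟨(Φ.trans H).trans Ψ'.symm, fun z hz => ?_, fun w => ?_, fun w => ?_⟩
  · simp only [Homeomorph.trans_apply]
    rw [HZ _ (mem_image_of_mem Φ hz)]
    simp
  · simp only [Homeomorph.trans_apply, Ss1, H1, Φ1]
  · refine Prod.ext (funext fun i => ?_) (funext fun i => ?_)
    · change (Ψ'.symm (H (Φ w))).1 i = w.1 i
      rw [Ss1, H1, Φ1]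
    · change (Ψ'.symm (H (Φ w))).2 i = w.2 i
      rw [SsB _ i i.2, HB _ i (hKB i i.2) fun hh => hh.1 i.2, ΦB _ i i.2]
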